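/- arXiv:1604.02159 — 4 statements merged into one kernel-verified Lean document; each statement's English description precedes it below -/
import Mathlib

section
/- A 3-step unipotent isometry is a product of three involutions of any prescribed types: let T be the matrix with rows (1, −√2, −1), (0, 1, √2), (0, 0, 1) (a 3-step unipotent element of SU(2,1), satisfying Tᴴ J T = J). Then for every sign pattern (ε₁,ε₂,ε₃) ∈ {−1,1}³ there exist involutive lifts I₁, I₂, I₃, with I_k a complex symmetry when ε_k = 1 and a central involution when ε_k = −1, and a nonzero scalar λ ∈ ℂ, such that T = λ · (I₁ I₂ I₃). -/
open Matrix

/-- The Hermitian form of signature (2,1) on ℂ³ (Siegel model):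
J₁₃ = J₂₂ = J₃₁ = 1, all other entries 0. -/
def Jsiegel : Matrix (Fin 3) (Fin 3) ℂ := !![0, 0, 1; 0, 1, 0; 1, 0, 0]

/-- Membership in U(2,1). -/
def InU21 (A : Matrix (Fin 3) (Fin 3) ℂ) : Prop := Aᴴ * Jsiegel * A = Jsiegel

/-- An involutive lift: a matrix in U(2,1) squaring to the identity with trace −1. -/
def IsInvLift (I : Matrix (Fin 3) (Fin 3) ℂ) : Prop :=
  InU21 I ∧ I * I = 1 ∧ I.trace = -1

/-- A central involution: an involutive lift whose fixed vector is of negative type. -/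
def IsCentral (I : Matrix (Fin 3) (Fin 3) ℂ) : Prop :=
  IsInvLift I ∧ ∃ v : Fin 3 → ℂ, v ≠ 0 ∧ I.mulVec v = v ∧
    (star v ⬝ᵥ Jsiegel.mulVec v).re < 0

/-- A complex symmetry: an involutive lift whose fixed vector is of positive type. -/
def IsSymmetry (I : Matrix (Fin 3) (Fin 3) ℂ) : Prop :=
  IsInvLift I ∧ ∃ v : Fin 3 → ℂ, v ≠ 0 ∧ I.mulVec v = v ∧
    0 < (star v ⬝ᵥ Jsiegel.mulVec v).re

/-- The involution `x ↦ -x + 2 ⟨x, v⟩ v / n` fixing a vector `v` of norm `n`. -/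
noncomputable def reflection (v : Fin 3 → ℂ) (n : ℝ) : Matrix (Fin 3) (Fin 3) ℂ :=
  -1 + (2 / (n : ℂ)) • vecMulVec v (Jsiegel *ᵥ star v)

lemma isInvLift_reflection {v : Fin 3 → ℂ} {n : ℝ} (hn : n ≠ 0)
    (hv : star v ⬝ᵥ Jsiegel *ᵥ v = n) : IsInvLift (reflection v n) := by
  have hn' : (n : ℂ) ≠ 0 := by exact_mod_cast hn
  have hv' : star (v 0) * v 2 + star (v 1) * v 1 + star (v 2) * v 0 = n := by
    simpa [dotProduct, mulVec, Jsiegel, Fin.sum_univ_three] using hv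
  have hk : (2 / (n : ℂ)) * (n : ℂ) = 2 := div_mul_cancel₀ _ hn'
  have hs : star (2 / (n : ℂ)) = 2 / (n : ℂ) := by simp
  unfold reflection
  generalize 2 / (n : ℂ) = k at hk hs
  simp only [Complex.star_def] at hv' hs
  refine ⟨?_, ?_, ?_⟩
  · unfold InU21
    ext i j
    fin_cases i <;> fin_cases j <;>
      simp [Matrix.mul_apply, Fin.sum_univ_three, Jsiegel, dotProduct, hs] <;> grind
  · ext i j
    fin_cases i <;> fin_cases j <;>
      simp [Matrix.mul_apply, Fin.sum_univ_three, Jsiegel, dotProduct] <;> grind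
  · simp [Matrix.trace, Fin.sum_univ_three, Jsiegel, dotProduct]
    grind

lemma reflection_mulVec_self {v : Fin 3 → ℂ} {n : ℝ} (hn : n ≠ 0)
    (hv : star v ⬝ᵥ Jsiegel *ᵥ v = n) : reflection v n *ᵥ v = v := by
  have hn' : (n : ℂ) ≠ 0 := by exact_mod_cast hn
  have hv' : star (v 0) * v 2 + star (v 1) * v 1 + star (v 2) * v 0 = n := by
    simpa [dotProduct, mulVec, Jsiegel, Fin.sum_univ_three] using hv
  have hk : (2 / (n : ℂ)) * (n : ℂ) = 2 := div_mul_cancel₀ _ hn'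
  unfold reflection
  generalize 2 / (n : ℂ) = k at hk
  simp only [Complex.star_def] at hv'
  ext i
  fin_cases i <;>
    simp [Fin.sum_univ_three, Jsiegel, mulVec, dotProduct] <;> grind

lemma isSymmetry_reflection {v : Fin 3 → ℂ} {n : ℝ} (hn : 0 < n)
    (hv : star v ⬝ᵥ Jsiegel *ᵥ v = n) : IsSymmetry (reflection v n) := by
  refine ⟨isInvLift_reflection hn.ne' hv, v, ?_, reflection_mulVec_self hn.ne' hv, by simpa [hv]⟩
  rintro rfl
  exact hn.ne (by exact_mod_cast (by simpa using hv : (0 : ℂ) = n))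

lemma isCentral_reflection {v : Fin 3 → ℂ} {n : ℝ} (hn : n < 0)
    (hv : star v ⬝ᵥ Jsiegel *ᵥ v = n) : IsCentral (reflection v n) := by
  refine ⟨isInvLift_reflection hn.ne hv, v, ?_, reflection_mulVec_self hn.ne hv, by simpa [hv]⟩
  rintro rfl
  exact hn.ne' (by exact_mod_cast (by simpa using hv : (0 : ℂ) = n))

lemma isSymmetry_and_isCentral_reflection {ε : ℤ} {v : Fin 3 → ℂ} {n : ℝ} (hε : 0 < ε * n)
    (hv : star v ⬝ᵥ Jsiegel *ᵥ v = n) :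
    (ε = 1 → IsSymmetry (reflection v n)) ∧ (ε = -1 → IsCentral (reflection v n)) := by
  constructor <;> rintro rfl
  · exact isSymmetry_reflection (by simpa using hε) hv
  · exact isCentral_reflection (by simpa using hε) hv

/-- `T` is, up to a nonzero scalar, a product of three involutions of types `ε₁, ε₂, ε₃`. -/
def IsTripleProduct (ε₁ ε₂ ε₃ : ℤ) (T : Matrix (Fin 3) (Fin 3) ℂ) : Prop :=
  ∃ (I₁ I₂ I₃ : Matrix (Fin 3) (Fin 3) ℂ) (c : ℂ),
    c ≠ 0 ∧
    (ε₁ = 1 → IsSymmetry I₁) ∧ (ε₁ = -1 → IsCentral I₁) ∧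
    (ε₂ = 1 → IsSymmetry I₂) ∧ (ε₂ = -1 → IsCentral I₂) ∧
    (ε₃ = 1 → IsSymmetry I₃) ∧ (ε₃ = -1 → IsCentral I₃) ∧
    T = c • (I₁ * I₂ * I₃)

lemma isTripleProduct_of_reflections {ε₁ ε₂ ε₃ : ℤ} {T : Matrix (Fin 3) (Fin 3) ℂ} (c : ℂ)
    (u v w : Fin 3 → ℂ) (k m n : ℝ) (hk : 0 < ε₁ * k) (hm : 0 < ε₂ * m) (hn : 0 < ε₃ * n)
    (hu : star u ⬝ᵥ Jsiegel *ᵥ u = k) (hv : star v ⬝ᵥ Jsiegel *ᵥ v = m)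
    (hw : star w ⬝ᵥ Jsiegel *ᵥ w = n) (hc : c ≠ 0)
    (hT : T * reflection w n = c • (reflection u k * reflection v m)) :
    IsTripleProduct ε₁ ε₂ ε₃ T := by
  obtain ⟨h₁, h₁'⟩ := isSymmetry_and_isCentral_reflection hk hu
  obtain ⟨h₂, h₂'⟩ := isSymmetry_and_isCentral_reflection hm hv
  obtain ⟨h₃, h₃'⟩ := isSymmetry_and_isCentral_reflection hn hw
  have hn₀ : n ≠ 0 := by rintro rfl; simp at hn
  refine ⟨_, _, _, c, hc, h₁, h₁', h₂, h₂', h₃, h₃', ?_⟩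
  rw [← Matrix.smul_mul, ← hT, Matrix.mul_assoc, (isInvLift_reflection hn₀ hw).2.1,
    Matrix.mul_one]

lemma isTripleProduct_symmSymmSymm {r d : ℂ} (hr : r * r = 2)
    (hr' : (starRingEnd ℂ) r = r) (hd : d * d = -3) (hd' : (starRingEnd ℂ) d = -d) :
    IsTripleProduct 1 1 1 !![1, -r, -1; 0, 1, r; 0, 0, 1] := by
  refine isTripleProduct_of_reflections ((-1 - d) / 2)
    ![-64 + 11 * d, 60 * r, -(16 * d)]
    ![-71 + 30 * d, r * (72 - 12 * d), -48 - 32 * d]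
    ![15, r * (28 * d), 48]
    6144 12288 6144
    (by norm_num) (by norm_num) (by norm_num) ?_ ?_ ?_ (by grind) ?_
  iterate 3
    simp [dotProduct, mulVec, Jsiegel, Fin.sum_univ_three, map_ofNat, hr', hd']
    grind
  ext i j
  fin_cases i <;> fin_cases j <;>
    simp [reflection, Matrix.mul_apply, Fin.sum_univ_three, Jsiegel, dotProduct, map_ofNat,
      hr', hd'] <;>
    grind

lemma isTripleProduct_centralCentralSymm {r d : ℂ} (hr : r * r = 2)
    (hr' : (starRingEnd ℂ) r = r) (hd : d * d = -3) (hd' : (starRingEnd ℂ) d = -d) :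
    IsTripleProduct (-1) (-1) 1 !![1, -r, -1; 0, 1, r; 0, 0, 1] := by
  refine isTripleProduct_of_reflections ((-1 - d) / 2)
    ![-50 - 27 * d, r * (36 + 24 * d), 96 + 16 * d]
    ![-43 - 46 * d, r * (24 + 36 * d), 144 + 32 * d]
    ![15, r * (28 * d), 48]
    (-6144) (-12288) 6144
    (by norm_num) (by norm_num) (by norm_num) ?_ ?_ ?_ (by grind) ?_
  iterate 3
    simp [dotProduct, mulVec, Jsiegel, Fin.sum_univ_three, map_ofNat, hr', hd']
    grind
  ext i j
  fin_cases i <;> fin_cases j <;>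
    simp [reflection, Matrix.mul_apply, Fin.sum_univ_three, Jsiegel, dotProduct, map_ofNat,
      hr', hd'] <;>
    grind

lemma isTripleProduct_symmCentralCentral {r d : ℂ} (hr : r * r = 2)
    (hr' : (starRingEnd ℂ) r = r) (hd : d * d = -3) (hd' : (starRingEnd ℂ) d = -d) :
    IsTripleProduct 1 (-1) (-1) !![1, -r, -1; 0, 1, r; 0, 0, 1] := by
  refine isTripleProduct_of_reflections ((-1 - d) / 2)
    ![-304 + 123 * d, r * (700 - 224 * d), -(784 * d)]
    ![61 - 574 * d, r * (-840 + 644 * d), 784 + 1568 * d]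
    ![-475, r * (84 * d), 784]
    702464 (-1404928) (-702464)
    (by norm_num) (by norm_num) (by norm_num) ?_ ?_ ?_ (by grind) ?_
  iterate 3
    simp [dotProduct, mulVec, Jsiegel, Fin.sum_univ_three, map_ofNat, hr', hd']
    grind
  ext i j
  fin_cases i <;> fin_cases j <;>
    simp [reflection, Matrix.mul_apply, Fin.sum_univ_three, Jsiegel, dotProduct, map_ofNat,
      hr', hd'] <;>
    grind

lemma isTripleProduct_centralSymmCentral {r d : ℂ} (hr : r * r = 2)
    (hr' : (starRingEnd ℂ) r = r) (hd : d * d = -3) (hd' : (starRingEnd ℂ) d = -d) :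
    IsTripleProduct (-1) 1 (-1) !![1, -r, -1; 0, 1, r; 0, 0, 1] := by
  refine isTripleProduct_of_reflections ((-1 - d) / 2)
    ![-182 - 1025 * d, r * (-980 + 1064 * d), 1568 + 2352 * d]
    ![-1277 + 1066 * d, r * (3640 - 1540 * d), -784 - 4704 * d]
    ![-475, r * (84 * d), 784]
    (-6322176) 12644352 (-702464)
    (by norm_num) (by norm_num) (by norm_num) ?_ ?_ ?_ (by grind) ?_
  iterate 3
    simp [dotProduct, mulVec, Jsiegel, Fin.sum_univ_three, map_ofNat, hr', hd']
    grind
  ext i j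
  fin_cases i <;> fin_cases j <;>
    simp [reflection, Matrix.mul_apply, Fin.sum_univ_three, Jsiegel, dotProduct, map_ofNat,
      hr', hd'] <;>
    grind

lemma isTripleProduct_symmSymmCentral {r : ℂ} (hr : r * r = 2)
    (hr' : (starRingEnd ℂ) r = r) :
    IsTripleProduct 1 1 (-1) !![1, -r, -1; 0, 1, r; 0, 0, 1] := by
  refine isTripleProduct_of_reflections 1
    ![-1, r, 0]
    ![-4, 0, -18]
    ![-4, 0, 18]
    2 144 (-144)
    (by norm_num) (by norm_num) (by norm_num) ?_ ?_ ?_ one_ne_zero ?_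
  iterate 3
    simp [dotProduct, mulVec, Jsiegel, Fin.sum_univ_three, map_ofNat, hr']
    grind
  ext i j
  fin_cases i <;> fin_cases j <;>
    simp [reflection, Matrix.mul_apply, Fin.sum_univ_three, Jsiegel, dotProduct, map_ofNat,
      hr'] <;>
    grind

lemma isTripleProduct_centralCentralCentral {r : ℂ} (hr : r * r = 2)
    (hr' : (starRingEnd ℂ) r = r) :
    IsTripleProduct (-1) (-1) (-1) !![1, -r, -1; 0, 1, r; 0, 0, 1] := by
  refine isTripleProduct_of_reflections 1
    ![-5, 9 * r, 18]
    ![-4, 8 * r, 18]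
    ![-4, 0, 18]
    (-18) (-16) (-144)
    (by norm_num) (by norm_num) (by norm_num) ?_ ?_ ?_ one_ne_zero ?_
  iterate 3
    simp [dotProduct, mulVec, Jsiegel, Fin.sum_univ_three, map_ofNat, hr']
    grind
  ext i j
  fin_cases i <;> fin_cases j <;>
    simp [reflection, Matrix.mul_apply, Fin.sum_univ_three, Jsiegel, dotProduct, map_ofNat,
      hr'] <;>
    grind

lemma isTripleProduct_symmCentralSymm {r : ℂ} (hr : r * r = 2)
    (hr' : (starRingEnd ℂ) r = r) :
    IsTripleProduct 1 (-1) 1 !![1, -r, -1; 0, 1, r; 0, 0, 1] := by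
  refine isTripleProduct_of_reflections 1
    ![-1, r, 0]
    ![-4, 0, 2]
    ![4, 0, 2]
    2 (-16) 16
    (by norm_num) (by norm_num) (by norm_num) ?_ ?_ ?_ one_ne_zero ?_
  iterate 3
    simp [dotProduct, mulVec, Jsiegel, Fin.sum_univ_three, map_ofNat, hr']
    grind
  ext i j
  fin_cases i <;> fin_cases j <;>
    simp [reflection, Matrix.mul_apply, Fin.sum_univ_three, Jsiegel, dotProduct, map_ofNat,
      hr'] <;>
    grind

lemma isTripleProduct_centralSymmSymm {r : ℂ} (hr : r * r = 2)
    (hr' : (starRingEnd ℂ) r = r) :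
    IsTripleProduct (-1) 1 1 !![1, -r, -1; 0, 1, r; 0, 0, 1] := by
  refine isTripleProduct_of_reflections 1
    ![-5, r, 2]
    ![-4, 8 * r, -2]
    ![4, 0, 2]
    (-18) 144 16
    (by norm_num) (by norm_num) (by norm_num) ?_ ?_ ?_ one_ne_zero ?_
  iterate 3
    simp [dotProduct, mulVec, Jsiegel, Fin.sum_univ_three, map_ofNat, hr']
    grind
  ext i j
  fin_cases i <;> fin_cases j <;>
    simp [reflection, Matrix.mul_apply, Fin.sum_univ_three, Jsiegel, dotProduct, map_ofNat,
      hr'] <;>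
    grind

/-- A 3-step unipotent isometry is a product of three involutions of any prescribed
types. -/
theorem three_step_unipotent_triple_product_any_type
    (ε₁ ε₂ ε₃ : ℤ)
    (hε₁ : ε₁ = 1 ∨ ε₁ = -1) (hε₂ : ε₂ = 1 ∨ ε₂ = -1) (hε₃ : ε₃ = 1 ∨ ε₃ = -1) :
    ∃ (I₁ I₂ I₃ : Matrix (Fin 3) (Fin 3) ℂ) (c : ℂ),
      c ≠ 0 ∧
      (ε₁ = 1 → IsSymmetry I₁) ∧ (ε₁ = -1 → IsCentral I₁) ∧
      (ε₂ = 1 → IsSymmetry I₂) ∧ (ε₂ = -1 → IsCentral I₂) ∧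
      (ε₃ = 1 → IsSymmetry I₃) ∧ (ε₃ = -1 → IsCentral I₃) ∧
      (!![1, -((Real.sqrt 2 : ℝ) : ℂ), -1; 0, 1, ((Real.sqrt 2 : ℝ) : ℂ); 0, 0, 1]
        : Matrix (Fin 3) (Fin 3) ℂ) = c • (I₁ * I₂ * I₃) := by
  have hr : ((Real.sqrt 2 : ℝ) : ℂ) * ((Real.sqrt 2 : ℝ) : ℂ) = 2 := by
    exact_mod_cast Real.mul_self_sqrt (by norm_num : (0 : ℝ) ≤ 2)
  have hr' : (starRingEnd ℂ) ((Real.sqrt 2 : ℝ) : ℂ) = ((Real.sqrt 2 : ℝ) : ℂ) :=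
    Complex.conj_ofReal _
  obtain ⟨d, hd, hd'⟩ : ∃ d : ℂ, d * d = -3 ∧ (starRingEnd ℂ) d = -d := by
    have h : ((Real.sqrt 3 : ℝ) : ℂ) * ((Real.sqrt 3 : ℝ) : ℂ) = 3 := by
      exact_mod_cast Real.mul_self_sqrt (by norm_num : (0 : ℝ) ≤ 3)
    exact ⟨Real.sqrt 3 * Complex.I, by linear_combination Complex.I * Complex.I * h + 3 * Complex.I_mul_I, by simp⟩
  generalize ((Real.sqrt 2 : ℝ) : ℂ) = r at hr hr' ⊢
  rcases hε₁ with rfl | rfl <;> rcases hε₂ with rfl | rfl <;> rcases hε₃ with rfl | rfl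
  · exact isTripleProduct_symmSymmSymm hr hr' hd hd'
  · exact isTripleProduct_symmSymmCentral hr hr'
  · exact isTripleProduct_symmCentralSymm hr hr'
  · exact isTripleProduct_symmCentralCentral hr hr' hd hd'
  · exact isTripleProduct_centralSymmSymm hr hr'
  · exact isTripleProduct_centralSymmCentral hr hr' hd hd'
  · exact isTripleProduct_centralCentralSymm hr hr' hd hd'
  · exact isTripleProduct_centralCentralCentral hr hr'
end

section
/- A 2-step unipotent isometry is a product of three complex symmetries: let P be the matrix with rows (1, 0, i), (0, 1, 0), (0, 0, 1) (a 2-step unipotent element of SU(2,1), satisfying Pᴴ J P = J). Then there exist involutive lifts I₁, I₂, I₃, all complex symmetries, and a nonzero scalar λ ∈ ℂ, such that P = λ · (I₁ I₂ I₃). -/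
open Matrix

/-- The linear map `w ↦ ⟨w, v⟩ v - w`, which for `⟨v, v⟩ = 2` is the reflection fixing `v`. -/
noncomputable def reflectionMatrix (v : Fin 3 → ℂ) : Matrix (Fin 3) (Fin 3) ℂ :=
  vecMulVec v (star v ᵥ* Jsiegel) - 1

theorem Jsiegel_conjTranspose : Jsiegelᴴ = Jsiegel := by
  ext i j
  fin_cases i <;> fin_cases j <;> simp [Jsiegel]

theorem isSymmetry_reflectionMatrix {v : Fin 3 → ℂ} (hv : star v ⬝ᵥ Jsiegel *ᵥ v = 2) :
    IsSymmetry (reflectionMatrix v) := by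
  have hv' : (star v ᵥ* Jsiegel) ⬝ᵥ v = 2 := by rw [← dotProduct_mulVec, hv]
  have hadj : (vecMulVec v (star v ᵥ* Jsiegel))ᴴ = vecMulVec (Jsiegel *ᵥ v) (star v) := by
    rw [conjTranspose_vecMulVec, star_vecMul, star_star, Jsiegel_conjTranspose]
  have hne : v ≠ 0 := by
    rintro rfl
    simp at hv
  refine ⟨⟨?_, ?_, ?_⟩, v, hne, ?_, ?_⟩
  · have h : vecMulVec (Jsiegel *ᵥ v) (star v) * Jsiegel
        = Jsiegel * vecMulVec v (star v ᵥ* Jsiegel) := by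
      rw [vecMulVec_mul, mul_vecMulVec]
    have h' : Jsiegel * vecMulVec v (star v ᵥ* Jsiegel) * vecMulVec v (star v ᵥ* Jsiegel)
        = (2 : ℂ) • (Jsiegel * vecMulVec v (star v ᵥ* Jsiegel)) := by
      rw [Matrix.mul_assoc, vecMulVec_mul_vecMulVec, hv', vecMulVec_smul, Matrix.mul_smul]
    rw [InU21, reflectionMatrix, conjTranspose_sub, hadj, conjTranspose_one, sub_mul, sub_mul, h,
      mul_sub, mul_sub, h', two_smul]
    simp
  · rw [reflectionMatrix, sub_mul, mul_sub, vecMulVec_mul_vecMulVec, hv', vecMulVec_smul, two_smul]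
    simp
  · rw [reflectionMatrix, trace_sub, trace_vecMulVec, dotProduct_comm, hv', trace_one]
    norm_num
  · rw [reflectionMatrix, sub_mulVec, vecMulVec_mulVec, hv', one_mulVec]
    ext i
    simp
    ring
  · rw [hv]
    norm_num

theorem reflectionMatrix_vec (a b c : ℂ) :
    reflectionMatrix ![a, b, c] =
      !![a * star c - 1, a * star b, a * star a;
         b * star c, b * star b - 1, b * star a;
         c * star c, c * star b, c * star a - 1] := by
  ext i j
  fin_cases i <;> fin_cases j <;>
    simp [reflectionMatrix, Jsiegel, vecHead, vecTail]

theorem Jsiegel_form_vec (a b c : ℂ) :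
    star ![a, b, c] ⬝ᵥ Jsiegel *ᵥ ![a, b, c] = star a * c + star b * b + star c * a := by
  simp [Jsiegel, mulVec, dotProduct, Fin.sum_univ_three]

/-- A 2-step unipotent isometry is a product of three complex symmetries. -/
theorem two_step_unipotent_product_three_symmetries :
    ∃ (I₁ I₂ I₃ : Matrix (Fin 3) (Fin 3) ℂ) (c : ℂ),
      c ≠ 0 ∧ IsSymmetry I₁ ∧ IsSymmetry I₂ ∧ IsSymmetry I₃ ∧
      (!![1, 0, Complex.I; 0, 1, 0; 0, 0, 1] : Matrix (Fin 3) (Fin 3) ℂ)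
        = c • (I₁ * I₂ * I₃) := by
  obtain ⟨q, p, μ, hqs, hps, hμs, hpq, hq, hμ, hI⟩ : ∃ q p μ : ℂ, star q = q ∧ star p = p ∧
      star μ = 1 - μ ∧ p * q = 1 ∧ q ^ 4 = 3 ∧ μ ^ 2 = μ - 1 ∧ Complex.I = (2 * μ - 1) * p ^ 2 := by
    have hr : √(√3) ≠ 0 := by positivity
    have h2 : (√(√3) : ℂ) ^ 2 = (√3 : ℂ) := by
      exact_mod_cast Real.sq_sqrt (Real.sqrt_nonneg 3)
    have h3 : (√3 : ℂ) ^ 2 = 3 := by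
      exact_mod_cast Real.sq_sqrt (show (0 : ℝ) ≤ 3 by norm_num)
    have hr' : (√(√3) : ℂ) ≠ 0 := by exact_mod_cast hr
    refine ⟨(√(√3) : ℝ), ((√(√3))⁻¹ : ℝ), (1 + Complex.I * (√3 : ℝ)) / 2,
      Complex.conj_ofReal _, Complex.conj_ofReal _, ?_, ?_, ?_, ?_, ?_⟩
    · simp
      ring
    · push_cast
      exact inv_mul_cancel₀ hr'
    · linear_combination ((√(√3) : ℂ) ^ 2 + √3) * h2 + h3
    · linear_combination (√3 : ℂ) ^ 2 / 4 * Complex.I_sq - h3 / 4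
    · push_cast
      field_simp
      linear_combination Complex.I * h2
  refine ⟨reflectionMatrix ![μ * p, 1, q], reflectionMatrix ![μ ^ 2 * p, 1, μ * q],
    reflectionMatrix ![p, 0, q], μ ^ 2, ?_, isSymmetry_reflectionMatrix ?_,
    isSymmetry_reflectionMatrix ?_, isSymmetry_reflectionMatrix ?_, ?_⟩
  · intro h
    have h1 : μ = 1 := by linear_combination h - hμ
    simp [h1] at h
  · rw [Jsiegel_form_vec]
    simp only [star_mul', star_one, hqs, hps, hμs]
    grind
  · rw [Jsiegel_form_vec]
    simp only [star_mul', star_pow, star_one, hqs, hps, hμs]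
    grind
  · rw [Jsiegel_form_vec]
    simp only [star_zero, hqs, hps]
    grind
  · simp only [reflectionMatrix_vec, star_mul', star_pow, star_one, star_zero, hqs, hps, hμs]
    ext i j
    fin_cases i <;> fin_cases j <;>
      simp <;> grind
end

section
/- A 2-step unipotent isometry is not a triple product of involutions of any type other than three complex symmetries: let P be the matrix with rows (1, 0, i), (0, 1, 0), (0, 0, 1) (a 2-step unipotent element of SU(2,1), satisfying Pᴴ J P = J). Then for all involutive lifts I₁, I₂, I₃ such that at least one I_k is a central involution, and for every scalar λ ∈ ℂ, one has P ≠ λ · (I₁ I₂ I₃). -/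
open Matrix

/-- For a `3 × 3` matrix, the adjugate is `A² - tr(A) A + σ₂(A)`. -/
lemma adjugate_fin_three_eq (A : Matrix (Fin 3) (Fin 3) ℂ) :
    A.adjugate = A * A - A.trace • A + ((A.trace ^ 2 - (A * A).trace) / 2) • 1 := by
  rw [adjugate_fin_three]
  ext i j
  fin_cases i <;> fin_cases j <;>
    simp [Matrix.trace_fin_three, Matrix.mul_apply, Fin.sum_univ_three] <;> ring

lemma Jsiegel_mul_self : Jsiegel * Jsiegel = 1 := by
  ext i j
  fin_cases i <;> fin_cases j <;> simp [Jsiegel, Matrix.mul_apply, Fin.sum_univ_three]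

namespace IsInvLift

variable {A B : Matrix (Fin 3) (Fin 3) ℂ}

lemma conjTranspose_mul_J (h : IsInvLift A) : Aᴴ * Jsiegel = Jsiegel * A := by
  obtain ⟨h1, h2, -⟩ := h
  calc Aᴴ * Jsiegel = Aᴴ * Jsiegel * (A * A) := by rw [h2, mul_one]
    _ = Aᴴ * Jsiegel * A * A := by simp only [mul_assoc]
    _ = Jsiegel * A := by rw [h1]

lemma conjTranspose_eq (h : IsInvLift A) : Aᴴ = Jsiegel * A * Jsiegel := by
  rw [← h.conjTranspose_mul_J, mul_assoc, Jsiegel_mul_self, mul_one]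

lemma det_eq_one (h : IsInvLift A) : A.det = 1 := by
  obtain ⟨-, h2, h3⟩ := h
  have h4 : A.adjugate = A := by
    rw [adjugate_fin_three_eq, h2, h3]
    simp only [trace_one, Fintype.card_fin]
    norm_num
  have h5 := congrFun (congrFun (mul_adjugate A) 0) 0
  rw [h4, h2] at h5
  simpa using h5.symm

lemma adjugate_add_one (h : IsInvLift A) : (A + 1).adjugate = 0 := by
  obtain ⟨-, h2, h3⟩ := h
  have h4 : (A + 1) * (A + 1) = (2 : ℂ) • (A + 1) := by
    rw [add_mul, mul_add, h2, two_smul]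
    simp
    abel
  have h5 : (A + 1).trace = 2 := by
    rw [trace_add, h3, trace_one]
    norm_num
  rw [adjugate_fin_three_eq, h4, trace_smul, h5]
  norm_num

/-- `A + 1` has rank one. -/
lemma add_one_mul_add_one (h : IsInvLift A) (i j : Fin 3) :
    (A + 1) 2 0 * (A + 1) i j = (A + 1) 2 j * (A + 1) i 0 := by
  have h1 := h.adjugate_add_one
  rw [adjugate_fin_three] at h1
  generalize A + 1 = N at *
  have e (k l : Fin 3) := congrFun (congrFun h1 k) l
  have e1 := e 1 0
  have e2 := e 1 2
  have e3 := e 2 0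
  have e4 := e 2 2
  have e5 := e 1 1
  have e6 := e 2 1
  simp at e1 e2 e3 e4 e5 e6
  fin_cases i <;> fin_cases j <;> simp <;> grind

/-- `J (A + 1)` is Hermitian. -/
lemma star_add_one_apply (h : IsInvLift A) (i j : Fin 3) :
    star ((A + 1) i j) = (A + 1) (Fin.rev j) (Fin.rev i) := by
  have h1 := congrFun (congrFun h.conjTranspose_eq j) i
  rw [conjTranspose_apply] at h1
  rw [Matrix.add_apply, star_add, h1]
  fin_cases i <;> fin_cases j <;>
    simp [Jsiegel, Matrix.mul_apply, Fin.sum_univ_three, Matrix.vecMul, dotProduct, Fin.rev]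

lemma apply_two_zero (h : IsInvLift A) : A 2 0 = ((A 2 0).re : ℂ) := by
  have h1 := h.star_add_one_apply 2 0
  simp [Fin.rev] at h1
  exact (Complex.conj_eq_iff_re.1 h1).symm

lemma trace_mul_real (hA : IsInvLift A) (hB : IsInvLift B) :
    (A * B).trace = ((A * B).trace.re : ℂ) := by
  have h : star (A * B).trace = (A * B).trace := by
    rw [← trace_conjTranspose, conjTranspose_mul, hA.conjTranspose_eq, hB.conjTranspose_eq]
    have e : Jsiegel * B * Jsiegel * (Jsiegel * A * Jsiegel) = Jsiegel * (B * A) * Jsiegel := by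
      simp only [mul_assoc]
      rw [← mul_assoc Jsiegel Jsiegel, Jsiegel_mul_self, one_mul]
    rw [e, trace_mul_comm, ← mul_assoc, Jsiegel_mul_self, one_mul, trace_mul_comm]
  exact (Complex.conj_eq_iff_re.1 h).symm

/-- The conjugate of an involutive lift by another one is an involutive lift. -/
lemma conj (hA : IsInvLift A) (hB : IsInvLift B) : IsInvLift (A * B * A) := by
  obtain ⟨a1, a2, a3⟩ := hA
  obtain ⟨b1, b2, b3⟩ := hB
  refine ⟨?_, ?_, ?_⟩
  · unfold InU21 at *
    calc (A * B * A)ᴴ * Jsiegel * (A * B * A)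
        = Aᴴ * (Bᴴ * (Aᴴ * Jsiegel * A) * B) * A := by
          simp only [conjTranspose_mul, mul_assoc]
      _ = Jsiegel := by rw [a1, b1, a1]
  · calc A * B * A * (A * B * A) = A * (B * (A * A) * B) * A := by simp only [mul_assoc]
      _ = 1 := by rw [a2, mul_one, b2, mul_one, a2]
  · rw [trace_mul_comm, ← mul_assoc, a2, one_mul, b3]

/-- The trace of the product of two central involutions is at least `3`. -/
lemma three_le_trace_mul (hA : IsInvLift A) (hB : IsInvLift B)
    (ha : (A 2 0).re < 0) (hb : (B 2 0).re < 0) : 3 ≤ (A * B).trace.re := by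
  have rA := hA.add_one_mul_add_one
  have rB := hB.add_one_mul_add_one
  have sA := hA.star_add_one_apply
  have sB := hB.star_add_one_apply
  have tA : (A + 1).trace = 2 := by
    rw [trace_add, hA.2.2, trace_one]; norm_num
  have tB : (B + 1).trace = 2 := by
    rw [trace_add, hB.2.2, trace_one]; norm_num
  have hT : (A * B).trace = ((A + 1) * (B + 1)).trace - 1 := by
    rw [add_mul, mul_add, trace_add, trace_add, mul_one, one_mul, tB, hA.2.2]; ring
  have hA0 : (A + 1) 2 0 = ((A 2 0).re : ℂ) := by
    rw [← hA.apply_two_zero]; simp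
  have hB0 : (B + 1) 2 0 = ((B 2 0).re : ℂ) := by
    rw [← hB.apply_two_zero]; simp
  rw [hT]
  generalize (A 2 0).re = a at *
  generalize (B 2 0).re = b at *
  generalize A + 1 = M at *
  generalize B + 1 = N at *
  have sA1 : M 2 1 = star (M 1 0) := by rw [sA]; rfl
  have sA2 : M 2 2 = star (M 0 0) := by rw [sA]; rfl
  have sB1 : N 2 1 = star (N 1 0) := by rw [sB]; rfl
  have sB2 : N 2 2 = star (N 0 0) := by rw [sB]; rfl
  have key : (a * b : ℂ) * (M * N).trace =
      (a * N 0 0 + star (M 1 0) * N 1 0 + star (M 0 0) * b) *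
        star (a * N 0 0 + star (M 1 0) * N 1 0 + star (M 0 0) * b) := by
    have e : (a * b : ℂ) * (M * N).trace =
        ∑ i, ∑ j, (M 2 j * M i 0) * (N 2 i * N j 0) := by
      simp only [← rA, ← rB]
      rw [hA0, hB0, Matrix.trace, Finset.mul_sum]
      refine Finset.sum_congr rfl fun i _ => ?_
      rw [diag_apply, Matrix.mul_apply, Finset.mul_sum]
      refine Finset.sum_congr rfl fun j _ => ?_
      ring
    rw [e]
    simp only [Fin.sum_univ_three, sA1, sA2, sB1, sB2, hA0, hB0]
    simp
    ring
  have nA := rA 1 1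
  have nB := rB 1 1
  rw [Matrix.trace_fin_three] at tA tB
  rw [sA1, hA0] at nA
  rw [sB1, hB0] at nB
  rw [sA2] at tA
  rw [sB2] at tB
  have nA' : a * (M 1 1).re = (M 1 0).re ^ 2 + (M 1 0).im ^ 2 := by
    have := congrArg Complex.re nA
    simp at this
    linarith
  have nB' : b * (N 1 1).re = (N 1 0).re ^ 2 + (N 1 0).im ^ 2 := by
    have := congrArg Complex.re nB
    simp at this
    linarith
  have tA' : 2 * (M 0 0).re + (M 1 1).re = 2 := by
    have := congrArg Complex.re tA
    simp at this
    linarith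
  have tB' : 2 * (N 0 0).re + (N 1 1).re = 2 := by
    have := congrArg Complex.re tB
    simp at this
    linarith
  set z := (a * N 0 0 + star (M 1 0) * N 1 0 + star (M 0 0) * b : ℂ) with hz
  have zre : z.re = a * (N 0 0).re + ((M 1 0).re * (N 1 0).re + (M 1 0).im * (N 1 0).im)
      + (M 0 0).re * b := by
    simp [hz]
  have key' : a * b * (M * N).trace.re = z.re ^ 2 + z.im ^ 2 := by
    have := congrArg Complex.re key
    rw [← Complex.ofReal_mul, Complex.re_ofReal_mul] at this
    rw [this]
    simp
    ring
  have hab : 0 < a * b := mul_pos_of_neg_of_neg ha hb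
  have id1 : 2 * (a * b) * (a + b - z.re) =
      (a * (N 1 0).re - b * (M 1 0).re) ^ 2 + (a * (N 1 0).im - b * (M 1 0).im) ^ 2 := by
    rw [zre]
    linear_combination (-2 * a * b ^ 2 * (1/2)) * tA' - a ^ 2 * b * tB' + b ^ 2 * nA' + a ^ 2 * nB'
  have hle : z.re ≤ a + b := by
    by_contra! hc
    nlinarith [sq_nonneg (a * (N 1 0).re - b * (M 1 0).re),
      sq_nonneg (a * (N 1 0).im - b * (M 1 0).im), mul_pos hab (sub_pos.2 hc)]
  have h4 : a * b * 4 ≤ a * b * (M * N).trace.re := by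
    rw [key']
    nlinarith [sq_nonneg (a - b), sq_nonneg z.im]
  have := le_of_mul_le_mul_left h4 hab
  simp
  linarith

lemma trace_mul_unipotent (h : IsInvLift A) :
    (A * !![1, 0, Complex.I; 0, 1, 0; 0, 0, 1]).trace = -1 + Complex.I * ((A 2 0).re : ℂ) := by
  rw [← h.apply_two_zero, ← h.2.2]
  simp [Matrix.trace_fin_three, Matrix.mul_apply, Fin.sum_univ_three]
  ring

end IsInvLift

namespace IsCentral

variable {A B : Matrix (Fin 3) (Fin 3) ℂ}

lemma apply_two_zero_neg (h : IsCentral A) : (A 2 0).re < 0 := by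
  obtain ⟨h, v, -, hv, hq⟩ := h
  have hN : (A + 1).mulVec v = (2 : ℂ) • v := by
    rw [add_mulVec, hv, one_mulVec, two_smul]
  have r := h.add_one_mul_add_one
  have s := h.star_add_one_apply
  have hA0 : (A + 1) 2 0 = ((A 2 0).re : ℂ) := by
    rw [← h.apply_two_zero]; simp
  generalize (A 2 0).re = a at *
  generalize A + 1 = N at *
  have e0 := congrFun hN 0
  have e1 := congrFun hN 1
  have e2 := congrFun hN 2
  simp only [mulVec, dotProduct, Fin.sum_univ_three, Pi.smul_apply, smul_eq_mul] at e0 e1 e2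
  have f2 := congrArg star e2
  have s1 : star (N 2 1) = N 1 0 := by rw [s]; rfl
  have s2 : star (N 2 2) = N 0 0 := by rw [s]; rfl
  have s0 : star (N 2 0) = N 2 0 := by rw [s]; rfl
  simp only [star_add, star_mul', s0, s1, s2, star_ofNat] at f2
  have q : star v ⬝ᵥ Jsiegel.mulVec v = star (v 0) * v 2 + star (v 1) * v 1 + star (v 2) * v 0 := by
    simp [dotProduct, mulVec, Jsiegel, Fin.sum_univ_three]
  have key : (a : ℂ) * (star v ⬝ᵥ Jsiegel.mulVec v) = 2 * (v 2 * star (v 2)) := by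
    rw [q, ← hA0]
    have r0 (j) := r 0 j
    have r1 (j) := r 1 j
    linear_combination (-1/2 * N 2 0) * (star (v 0) * e2 + star (v 1) * e1 + star (v 2) * e0)
      + (1/2) * (star (v 1) * (v 0 * r 1 0 + v 1 * r 1 1 + v 2 * r 1 2)
        + star (v 2) * (v 0 * r 0 0 + v 1 * r 0 1 + v 2 * r 0 2))
      + (1/2) * (N 2 0 * v 0 + N 2 1 * v 1 + N 2 2 * v 2) * f2 + star (v 2) * e2
  have key' : a * (star v ⬝ᵥ Jsiegel.mulVec v).re = 2 * ((v 2).re ^ 2 + (v 2).im ^ 2) := by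
    have := congrArg Complex.re key
    rw [Complex.re_ofReal_mul] at this
    rw [this]
    simp
    ring
  by_contra! ha
  have h0 : (v 2).re ^ 2 + (v 2).im ^ 2 ≤ 0 := by
    nlinarith
  have hr : (v 2).re = 0 := by nlinarith [sq_nonneg (v 2).re, sq_nonneg (v 2).im]
  have hi : (v 2).im = 0 := by nlinarith [sq_nonneg (v 2).re, sq_nonneg (v 2).im]
  rw [q] at hq
  simp [hr, hi] at hq
  nlinarith [sq_nonneg (v 1).re, sq_nonneg (v 1).im]

lemma conj (hA : IsInvLift A) (hB : IsCentral B) : IsCentral (A * B * A) := by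
  obtain ⟨hB, v, hv, hBv, hq⟩ := hB
  refine ⟨hA.conj hB, A.mulVec v, ?_, ?_, ?_⟩
  · intro h0
    apply hv
    rw [← one_mulVec v, ← hA.2.1, ← mulVec_mulVec, h0, mulVec_zero]
  · rw [mulVec_mulVec, mul_assoc (A * B), hA.2.1, mul_one, ← mulVec_mulVec, hBv]
  · rwa [star_mulVec, mulVec_mulVec, ← dotProduct_mulVec, mulVec_mulVec, ← mul_assoc,
      show Aᴴ * Jsiegel * A = Jsiegel from hA.1]

end IsCentral

/-- A cube root of unity proportional over `ℝ` to `-1 + i a` with `a < 0` lies in the third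
quadrant on the line `re = -1/2`. -/
lemma cube_root_of_real_mul {c : ℂ} {r a : ℝ} (hc : c ^ 3 = 1)
    (h : -1 + Complex.I * (a : ℂ) = c * (r : ℂ)) (ha : a < 0) : c.re = -1 / 2 ∧ c.im < 0 := by
  have hre := congrArg Complex.re h
  have him := congrArg Complex.im h
  have e : (-1 + Complex.I * (a : ℂ)) ^ 3 = (r ^ 3 : ℝ) := by
    rw [h, mul_pow, hc, one_mul, Complex.ofReal_pow]
  have e1 := congrArg Complex.re e
  have e2 := congrArg Complex.im e
  rw [Complex.ofReal_re] at e1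
  rw [Complex.ofReal_im] at e2
  simp [pow_succ] at hre him e1 e2
  have a2 : a ^ 2 = 3 := by
    have : a * (3 - a ^ 2) = 0 := by linear_combination e2
    rcases mul_eq_zero.1 this with h | h
    · exact absurd h ha.ne
    · linarith
  have r2 : r = 2 := by
    have : (r - 2) * (r ^ 2 + 2 * r + 4) = 0 := by linear_combination -e1 + 3 * a2
    rcases mul_eq_zero.1 this with h | h
    · linarith
    · nlinarith [sq_nonneg (r + 1)]
  subst r2
  constructor <;> linarith

/-- A 2-step unipotent isometry is not a triple product of involutions of any type
other than three complex symmetries: if at least one of the three involutions is a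
central involution, the product cannot be the given 2-step unipotent map. -/
theorem two_step_unipotent_not_other_triple_products
    (I₁ I₂ I₃ : Matrix (Fin 3) (Fin 3) ℂ)
    (h₁ : IsInvLift I₁) (h₂ : IsInvLift I₂) (h₃ : IsInvLift I₃)
    (hcen : IsCentral I₁ ∨ IsCentral I₂ ∨ IsCentral I₃) (c : ℂ) :
    (!![1, 0, Complex.I; 0, 1, 0; 0, 0, 1] : Matrix (Fin 3) (Fin 3) ℂ)
      ≠ c • (I₁ * I₂ * I₃) := by
  intro hP
  have hc : c ^ 3 = 1 := by
    have := congrArg Matrix.det hP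
    rw [det_smul, det_mul, det_mul, h₁.det_eq_one, h₂.det_eq_one, h₃.det_eq_one,
      det_fin_three] at this
    simpa using this.symm
  have h12 := h₁.conj h₂
  have t1 : -1 + Complex.I * ((I₁ 2 0).re : ℂ) = c * ((I₂ * I₃).trace.re : ℂ) := by
    rw [← h₂.trace_mul_real h₃, ← h₁.trace_mul_unipotent, hP, mul_smul_comm, trace_smul,
      mul_assoc, ← mul_assoc I₁ I₁, h₁.2.1, one_mul, smul_eq_mul]
  have t2 : -1 + Complex.I * (((I₁ * I₂ * I₁) 2 0).re : ℂ) = c * ((I₁ * I₃).trace.re : ℂ) := by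
    rw [← h₁.trace_mul_real h₃, ← h12.trace_mul_unipotent, hP, mul_smul_comm, trace_smul,
      mul_assoc I₁ I₂ I₃, mul_assoc (I₁ * I₂), ← mul_assoc I₁ I₁, h₁.2.1, one_mul,
      mul_assoc I₁ I₂, ← mul_assoc I₂ I₂, h₂.2.1, one_mul, smul_eq_mul]
  have t3 : -1 + Complex.I * ((I₃ 2 0).re : ℂ) = c * ((I₁ * I₂).trace.re : ℂ) := by
    rw [← h₁.trace_mul_real h₂, ← h₃.trace_mul_unipotent, hP, mul_smul_comm, trace_smul,
      trace_mul_comm, mul_assoc, h₃.2.1, mul_one, smul_eq_mul]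
  obtain ⟨hre, him⟩ : c.re = -1 / 2 ∧ c.im < 0 := by
    rcases hcen with h | h | h
    · exact cube_root_of_real_mul hc t1 h.apply_two_zero_neg
    · exact cube_root_of_real_mul hc t2 (IsCentral.conj h₁ h).apply_two_zero_neg
    · exact cube_root_of_real_mul hc t3 h.apply_two_zero_neg
  have two {a r : ℝ} (h : -1 + Complex.I * (a : ℂ) = c * (r : ℂ)) : r = 2 ∧ a < 0 := by
    have e1 := congrArg Complex.re h
    have e2 := congrArg Complex.im h
    simp [hre] at e1 e2
    have hr : r = 2 := by linarith
    subst hr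
    exact ⟨rfl, by linarith⟩
  have := h₁.three_le_trace_mul h₃ (two t1).2 (two t3).2
  linarith [(two t2).1]
end

section
/- A half-turn parabolic isometry cannot be written as a product of one complex symmetry and two central involutions: let Q be the matrix with rows (−1, 0, −i), (0, 1, 0), (0, 0, −1) (a half-turn parabolic element of SU(2,1), satisfying Qᴴ J Q = J). Then for all involutive lifts I₁, I₂, I₃ such that exactly one of them is a complex symmetry and the other two are central involutions, and for every scalar λ ∈ ℂ, one has Q ≠ λ · (I₁ I₂ I₃). -/
open Matrix

/-- The Hermitian form `⟨v, w⟩ = vᴴ J w` of the Siegel model. -/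
noncomputable def siegelForm (v w : Fin 3 → ℂ) : ℂ := star v ⬝ᵥ Jsiegel *ᵥ w

lemma siegelForm_apply (v w : Fin 3 → ℂ) :
    siegelForm v w = star (v 0) * w 2 + star (v 1) * w 1 + star (v 2) * w 0 := by
  simp [siegelForm, Jsiegel, dotProduct, mulVec, Fin.sum_univ_three]

lemma star_vecMul_Jsiegel (v : Fin 3 → ℂ) :
    star v ᵥ* Jsiegel = ![star (v 2), star (v 1), star (v 0)] := by
  ext i
  fin_cases i <;> simp [Jsiegel, vecMul, dotProduct, Fin.sum_univ_three]

lemma siegelForm_self_eq_re (v : Fin 3 → ℂ) :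
    siegelForm v v = ((siegelForm v v).re : ℂ) := by
  rw [siegelForm_apply]
  apply Complex.ext <;> simp
  ring

lemma siegelForm_smul_smul (t : ℂ) (v w : Fin 3 → ℂ) :
    siegelForm (t • v) (t • w) = Complex.normSq t * siegelForm v w := by
  simp only [siegelForm_apply, Pi.smul_apply, smul_eq_mul, ← starRingEnd_apply, map_mul,
    Complex.normSq_eq_conj_mul_self]
  ring

lemma InU21.siegelForm_mulVec {A : Matrix (Fin 3) (Fin 3) ℂ} (hA : InU21 A) (v w : Fin 3 → ℂ) :
    siegelForm (A *ᵥ v) (A *ᵥ w) = siegelForm v w := by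
  unfold siegelForm
  rw [star_mulVec, ← dotProduct_mulVec, mulVec_mulVec, mulVec_mulVec, hA]

/-- The linear involution fixing `v` and acting as `-1` on the orthogonal complement of `v`. -/
noncomputable def lineReflection (v : Fin 3 → ℂ) : Matrix (Fin 3) (Fin 3) ℂ :=
  -1 + (2 / siegelForm v v) • vecMulVec v (star v ᵥ* Jsiegel)

lemma lineReflection_smul {t : ℂ} (ht : t ≠ 0) (v : Fin 3 → ℂ) :
    lineReflection (t • v) = lineReflection v := by
  have ht' : star t ≠ 0 := star_ne_zero.mpr ht
  rw [lineReflection, lineReflection, siegelForm_smul_smul, star_smul, smul_vecMul, smul_vecMulVec,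
    vecMulVec_smul, smul_smul, smul_smul, Complex.normSq_eq_conj_mul_self, starRingEnd_apply]
  congr 2
  by_cases h : siegelForm v v = 0
  · simp [h]
  · field_simp

lemma lineReflection_mul_self {v : Fin 3 → ℂ} (hv : siegelForm v v ≠ 0) :
    lineReflection v * lineReflection v = 1 := by
  have h : vecMulVec v (star v ᵥ* Jsiegel) * vecMulVec v (star v ᵥ* Jsiegel)
      = siegelForm v v • vecMulVec v (star v ᵥ* Jsiegel) := by
    rw [vecMulVec_mul_vecMulVec, ← dotProduct_mulVec, vecMulVec_smul]
    rfl
  simp only [lineReflection, add_mul, mul_add, smul_mul_assoc, mul_smul_comm, h, smul_smul,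
    neg_mul, mul_neg, one_mul, mul_one]
  rw [div_mul_cancel₀ _ hv]
  module

lemma det_lineReflection {v : Fin 3 → ℂ} (hv : siegelForm v v ≠ 0) :
    (lineReflection v).det = 1 := by
  obtain ⟨k, hk⟩ : ∃ k, k = 2 / siegelForm v v := ⟨_, rfl⟩
  have hk2 : k * siegelForm v v = 2 := by rw [hk, div_mul_cancel₀ _ hv]
  rw [siegelForm_apply] at hk2
  rw [lineReflection, ← hk, det_fin_three]
  simp [star_vecMul_Jsiegel] at hk2 ⊢
  linear_combination hk2

lemma trace_lineReflection_mul (v w : Fin 3 → ℂ) (hv : siegelForm v v ≠ 0)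
    (hw : siegelForm w w ≠ 0) :
    (lineReflection v * lineReflection w).trace =
      -1 + 4 * Complex.normSq (siegelForm v w) / (siegelForm v v * siegelForm w w) := by
  have hconj : siegelForm w v = star (siegelForm v w) := by
    simp [siegelForm_apply]
    ring
  have htr (u : Fin 3 → ℂ) : (vecMulVec u (star u ᵥ* Jsiegel)).trace = siegelForm u u := by
    rw [trace_vecMulVec, dotProduct_comm, ← dotProduct_mulVec]
    rfl
  have hvw : (vecMulVec v (star v ᵥ* Jsiegel) * vecMulVec w (star w ᵥ* Jsiegel)).trace
      = siegelForm v w * siegelForm w v := by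
    rw [vecMulVec_mul_vecMulVec, vecMulVec_smul, trace_smul, trace_vecMulVec, dotProduct_comm v,
      ← dotProduct_mulVec, ← dotProduct_mulVec]
    rfl
  simp only [lineReflection, add_mul, mul_add, smul_mul_assoc, mul_smul_comm,
    neg_mul, mul_neg, one_mul, mul_one, trace_add, trace_neg, trace_smul, htr, hvw,
    trace_one, hconj, smul_eq_mul]
  rw [Complex.normSq_eq_conj_mul_self, starRingEnd_apply]
  field_simp
  simp
  ring

lemma IsInvLift.eq_lineReflection {I : Matrix (Fin 3) (Fin 3) ℂ} (hI : IsInvLift I)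
    {v : Fin 3 → ℂ} (hfix : I *ᵥ v = v) (hv : siegelForm v v ≠ 0) : I = lineReflection v := by
  obtain ⟨hU, hsq, htr⟩ := hI
  set w := star v ᵥ* Jsiegel with hw
  have hIJ : Iᴴ * Jsiegel = Jsiegel * I := by
    calc Iᴴ * Jsiegel = Iᴴ * Jsiegel * (I * I) := by rw [hsq, mul_one]
      _ = (Iᴴ * Jsiegel * I) * I := by simp only [mul_assoc]
      _ = Jsiegel * I := by rw [hU]
  have hwI : w ᵥ* I = w := by
    rw [hw, vecMul_vecMul, ← hIJ, ← vecMul_vecMul, ← star_mulVec, hfix]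
  have hwv : w ⬝ᵥ v = siegelForm v v := (dotProduct_mulVec _ _ _).symm
  obtain ⟨n, hn⟩ : ∃ n, n = siegelForm v v := ⟨_, rfl⟩
  rw [← hn] at hwv hv
  have hRR : vecMulVec v w * vecMulVec v w = n • vecMulVec v w := by
    rw [vecMulVec_mul_vecMulVec, hwv, vecMulVec_smul]
  have hIR : I * vecMulVec v w = vecMulVec v w := by rw [mul_vecMulVec, hfix]
  have hRI : vecMulVec v w * I = vecMulVec v w := by rw [vecMulVec_mul, hwI]
  have hidem : IsIdempotentElem ((1 / 2 : ℂ) • (1 + I) - (1 / n) • vecMulVec v w) := by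
    unfold IsIdempotentElem
    simp only [sub_mul, mul_sub, add_mul, mul_add, smul_mul_assoc, mul_smul_comm, one_mul, mul_one,
      hRR, hIR, hRI, hsq, smul_smul]
    rw [one_div_mul_cancel hv]
    module
  have htrace : ((1 / 2 : ℂ) • (1 + I) - (1 / n) • vecMulVec v w).trace = 0 := by
    rw [trace_sub, trace_smul, trace_smul, trace_add, htr, trace_one, trace_vecMulVec,
      dotProduct_comm, hwv]
    simp [hv]
    norm_num
  have hzero : (1 / 2 : ℂ) • (1 + I) - (1 / n) • vecMulVec v w = 0 := by
    apply (toLin' (R := ℂ)).injective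
    rw [map_zero]
    refine (LinearMap.IsIdempotentElem.trace_eq_zero_iff ?_).mp ?_
    · unfold IsIdempotentElem
      rw [Module.End.mul_eq_comp, ← toLin'_mul, hidem]
    · rw [trace_toLin'_eq, htrace]
  rw [lineReflection, ← hw, ← hn]
  have h2 : (2 : ℂ) • ((1 / 2 : ℂ) • (1 + I) - (1 / n) • vecMulVec v w) = 0 := by
    rw [hzero, smul_zero]
  rw [← sub_eq_zero, ← h2]
  module

lemma IsCentral.exists_eq_lineReflection {I : Matrix (Fin 3) (Fin 3) ℂ} (h : IsCentral I) :
    ∃ v : Fin 3 → ℂ, v 2 = 1 ∧ (siegelForm v v).re < 0 ∧ I = lineReflection v := by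
  obtain ⟨hI, v, -, hfix, hneg⟩ := h
  change (siegelForm v v).re < 0 at hneg
  have h2 : v 2 ≠ 0 := by
    intro h0
    rw [siegelForm_apply, h0] at hneg
    simp at hneg
    nlinarith [mul_self_nonneg (v 1).re, mul_self_nonneg (v 1).im]
  refine ⟨(v 2)⁻¹ • v, by simp [h2], ?_, ?_⟩
  · rw [siegelForm_smul_smul, Complex.re_ofReal_mul]
    exact mul_neg_of_pos_of_neg (Complex.normSq_pos.mpr (inv_ne_zero h2)) hneg
  · rw [lineReflection_smul (inv_ne_zero h2)]
    exact hI.eq_lineReflection hfix fun h0 => by simp [h0] at hneg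

lemma IsSymmetry.exists_eq_lineReflection {I : Matrix (Fin 3) (Fin 3) ℂ} (h : IsSymmetry I) :
    ∃ v : Fin 3 → ℂ, 0 < (siegelForm v v).re ∧ I = lineReflection v := by
  obtain ⟨hI, v, -, hfix, hpos⟩ := h
  change 0 < (siegelForm v v).re at hpos
  exact ⟨v, hpos, hI.eq_lineReflection hfix fun h0 => by simp [h0] at hpos⟩

/-- Reversed Cauchy–Schwarz inequality for vectors of negative type. -/
lemma mul_le_normSq_siegelForm {v w : Fin 3 → ℂ} (hv2 : v 2 = 1) (hw2 : w 2 = 1)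
    (hv : (siegelForm v v).re < 0) (hw : (siegelForm w w).re < 0) :
    (siegelForm v v).re * (siegelForm w w).re ≤ Complex.normSq (siegelForm v w) := by
  have hre : 2 * (siegelForm v w).re = (siegelForm v v).re + (siegelForm w w).re
      - Complex.normSq (v 1 - w 1) := by
    simp [siegelForm_apply, hv2, hw2, Complex.normSq_apply]
    ring
  have hn := Complex.normSq_nonneg (v 1 - w 1)
  rw [Complex.normSq_apply]
  nlinarith [sq_nonneg ((siegelForm v v).re - (siegelForm w w).re),
    mul_self_nonneg (siegelForm v w).im]

lemma three_le_trace_lineReflection_mul {v w : Fin 3 → ℂ} (hv2 : v 2 = 1) (hw2 : w 2 = 1)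
    (hv : (siegelForm v v).re < 0) (hw : (siegelForm w w).re < 0) :
    ∃ r : ℝ, 3 ≤ r ∧ (lineReflection v * lineReflection w).trace = r := by
  refine ⟨-1 + 4 * Complex.normSq (siegelForm v w) /
    ((siegelForm v v).re * (siegelForm w w).re), ?_, ?_⟩
  · have h := mul_le_normSq_siegelForm hv2 hw2 hv hw
    have h4 : 4 ≤ 4 * Complex.normSq (siegelForm v w) /
        ((siegelForm v v).re * (siegelForm w w).re) := by
      rw [le_div_iff₀ (mul_pos_of_neg_of_neg hv hw)]
      linarith
    linarith
  · rw [trace_lineReflection_mul v w (fun h0 => by simp [h0] at hv) (fun h0 => by simp [h0] at hw)]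
    push_cast
    rw [← siegelForm_self_eq_re, ← siegelForm_self_eq_re]

/-- Conjugation of one involutive lift by another one. -/
lemma IsInvLift.conj_s14 {S I : Matrix (Fin 3) (Fin 3) ℂ} (hS : IsInvLift S) (hI : IsInvLift I) :
    IsInvLift (S * I * S) := by
  obtain ⟨hSU, hSS, -⟩ := hS
  obtain ⟨hIU, hII, hIt⟩ := hI
  refine ⟨?_, ?_, ?_⟩
  · unfold InU21 at *
    calc (S * I * S)ᴴ * Jsiegel * (S * I * S)
        = Sᴴ * (Iᴴ * (Sᴴ * Jsiegel * S) * I) * S := by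
          simp only [conjTranspose_mul, mul_assoc]
      _ = Jsiegel := by rw [hSU, hIU, hSU]
  · calc S * I * S * (S * I * S) = S * (I * (S * S) * I) * S := by simp only [mul_assoc]
      _ = 1 := by rw [hSS, mul_one, hII, mul_one, hSS]
  · rw [trace_mul_comm, ← mul_assoc, hSS, one_mul, hIt]

lemma IsCentral.conj_s14 {S I : Matrix (Fin 3) (Fin 3) ℂ} (hS : IsInvLift S) (hI : IsCentral I) :
    IsCentral (S * I * S) := by
  obtain ⟨hI, v, hv0, hfix, hneg⟩ := hI
  have hback : S *ᵥ (S *ᵥ v) = v := by rw [mulVec_mulVec, hS.2.1, one_mulVec]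
  refine ⟨hS.conj_s14 hI, S *ᵥ v, ?_, ?_, ?_⟩
  · intro h0
    rw [h0, mulVec_zero] at hback
    exact hv0 hback.symm
  · rw [← mulVec_mulVec, hback, ← mulVec_mulVec, hfix]
  · change (siegelForm _ _).re < 0
    rwa [hS.1.siegelForm_mulVec]

/-- The half-turn parabolic element. -/
noncomputable def halfTurnParabolic : Matrix (Fin 3) (Fin 3) ℂ :=
  !![-1, 0, -Complex.I; 0, 1, 0; 0, 0, -1]

lemma trace_halfTurnParabolic_mul_lineReflection {v : Fin 3 → ℂ} (hv : siegelForm v v ≠ 0) :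
    (halfTurnParabolic * lineReflection v).trace = -1 + (4 * Complex.normSq (v 1)
      - 2 * Complex.I * Complex.normSq (v 2)) / siegelForm v v := by
  obtain ⟨k, hk⟩ : ∃ k, k = 2 / siegelForm v v := ⟨_, rfl⟩
  have hk2 : k * siegelForm v v = 2 := by rw [hk, div_mul_cancel₀ _ hv]
  have hk' : (4 * Complex.normSq (v 1) - 2 * Complex.I * Complex.normSq (v 2)) / siegelForm v v
      = k * (2 * Complex.normSq (v 1) - Complex.I * Complex.normSq (v 2)) := by
    rw [hk]
    field_simp
    ring
  rw [hk', lineReflection, ← hk]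
  rw [siegelForm_apply] at hk2
  simp [trace, halfTurnParabolic, star_vecMul_Jsiegel, vecMul, dotProduct,
    Fin.sum_univ_three, Complex.normSq_eq_conj_mul_self] at hk2 ⊢
  linear_combination -hk2

/-- If the product of two central involutions fixes the null vector `e₁`, they coincide. -/
lemma lineReflection_eq_of_mulVec_single {v w : Fin 3 → ℂ} (hv2 : v 2 = 1) (hw2 : w 2 = 1)
    (hv : siegelForm v v ≠ 0)
    (h : lineReflection v *ᵥ ![1, 0, 0] = lineReflection w *ᵥ ![1, 0, 0]) : v = w := by
  have key (u : Fin 3 → ℂ) (hu : u 2 = 1) : lineReflection u *ᵥ ![1, 0, 0]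
      = -![1, 0, 0] + (2 / siegelForm u u) • u := by
    rw [lineReflection, add_mulVec, neg_mulVec, one_mulVec, smul_mulVec, vecMulVec_mulVec]
    congr 2
    ext i
    simp [star_vecMul_Jsiegel, hu]
  rw [key v hv2, key w hw2, add_right_inj] at h
  have h2 := congrFun h 2
  simp only [Pi.smul_apply, smul_eq_mul, hv2, hw2, mul_one] at h2
  rw [← h2] at h
  exact smul_right_injective _ (div_ne_zero two_ne_zero hv) h

lemma halfTurnParabolic_ne_of_central_central_symmetry {A B S : Matrix (Fin 3) (Fin 3) ℂ}
    (hA : IsCentral A) (hB : IsCentral B) (hS : IsSymmetry S) (c : ℂ) :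
    halfTurnParabolic ≠ c • (A * B * S) := by
  intro h
  obtain ⟨a, ha2, ha, rfl⟩ := hA.exists_eq_lineReflection
  obtain ⟨b, hb2, hb, rfl⟩ := hB.exists_eq_lineReflection
  obtain ⟨s, hs, rfl⟩ := hS.exists_eq_lineReflection
  have ha0 : siegelForm a a ≠ 0 := fun h0 => by simp [h0] at ha
  have hb0 : siegelForm b b ≠ 0 := fun h0 => by simp [h0] at hb
  have hs0 : siegelForm s s ≠ 0 := fun h0 => by simp [h0] at hs
  have hc : c ^ 3 = 1 := by
    have hd := congrArg det h
    rw [det_smul, det_mul, det_mul, det_lineReflection ha0, det_lineReflection hb0,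
      det_lineReflection hs0] at hd
    simpa [halfTurnParabolic, det_fin_three] using hd.symm
  have hmul : halfTurnParabolic * lineReflection s
      = c • (lineReflection a * lineReflection b) := by
    rw [h, smul_mul_assoc, mul_assoc, lineReflection_mul_self hs0, mul_one]
  obtain ⟨r, hr, htr⟩ := three_le_trace_lineReflection_mul ha2 hb2 ha hb
  have htrace := congrArg trace hmul
  rw [trace_halfTurnParabolic_mul_lineReflection hs0, trace_smul, htr, siegelForm_self_eq_re s,
    smul_eq_mul] at htrace
  have hre := congrArg Complex.re htrace
  have him := congrArg Complex.im htrace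
  simp only [Complex.add_re, Complex.add_im, Complex.div_ofReal_re, Complex.div_ofReal_im] at hre him
  simp at hre him
  have hx : 0 ≤ 4 * Complex.normSq (s 1) / (siegelForm s s).re := by
    have := Complex.normSq_nonneg (s 1)
    positivity
  have hfactor : (c - 1) * (c ^ 2 + c + 1) = 0 := by linear_combination hc
  rcases mul_eq_zero.mp hfactor with h1 | h1
  · obtain rfl : c = 1 := sub_eq_zero.mp h1
    have hs2 : s 2 = 0 := by
      simpa [hs.ne'] using him
    rw [one_smul] at h hmul
    have hfix : (halfTurnParabolic * lineReflection s) *ᵥ ![1, 0, 0] = ![1, 0, 0] := by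
      ext i
      fin_cases i <;>
        simp [halfTurnParabolic, lineReflection, mulVec, dotProduct,
          star_vecMul_Jsiegel, mul_apply, Fin.sum_univ_three, hs2]
    have hab : a = b := by
      refine lineReflection_eq_of_mulVec_single ha2 hb2 ha0 ?_
      rw [hmul] at hfix
      nth_rewrite 1 [← hfix]
      rw [mulVec_mulVec, ← mul_assoc, lineReflection_mul_self ha0, one_mul]
    rw [hab, lineReflection_mul_self hb0, one_mul] at h
    have hsq := lineReflection_mul_self hs0
    rw [← h] at hsq
    have h02 := congrFun (congrFun hsq 0) 2
    simp [halfTurnParabolic, mul_apply, Fin.sum_univ_three] at h02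
  · have h1re := congrArg Complex.re h1
    have h1im := congrArg Complex.im h1
    simp [pow_two] at h1re h1im
    have hq : c.im ≠ 0 := by
      intro h0
      rw [h0] at h1re
      nlinarith [sq_nonneg (2 * c.re + 1)]
    have hp : 2 * c.re + 1 = 0 := by
      apply mul_right_cancel₀ hq
      linarith
    nlinarith

/-- A half-turn parabolic isometry cannot be written as a product of one complex
symmetry and two central involutions. -/
theorem half_turn_parabolic_not_symmetry_two_central
    (I₁ I₂ I₃ : Matrix (Fin 3) (Fin 3) ℂ)
    (h : (IsSymmetry I₁ ∧ IsCentral I₂ ∧ IsCentral I₃) ∨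
         (IsCentral I₁ ∧ IsSymmetry I₂ ∧ IsCentral I₃) ∨
         (IsCentral I₁ ∧ IsCentral I₂ ∧ IsSymmetry I₃))
    (c : ℂ) :
    (!![-1, 0, -Complex.I; 0, 1, 0; 0, 0, -1] : Matrix (Fin 3) (Fin 3) ℂ)
      ≠ c • (I₁ * I₂ * I₃) := by
  change halfTurnParabolic ≠ _
  rcases h with ⟨hS, hA, hB⟩ | ⟨hA, hS, hB⟩ | ⟨hA, hB, hS⟩
  · have hmove : I₁ * I₂ * I₃ = (I₁ * I₂ * I₁) * (I₁ * I₃ * I₁) * I₁ := by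
      calc I₁ * I₂ * I₃ = I₁ * I₂ * (I₁ * I₁) * I₃ * (I₁ * I₁) := by simp [hS.1.2.1]
        _ = _ := by simp only [mul_assoc]
    rw [hmove]
    exact halfTurnParabolic_ne_of_central_central_symmetry (hA.conj_s14 hS.1) (hB.conj_s14 hS.1) hS c
  · have hmove : I₁ * I₂ * I₃ = I₁ * (I₂ * I₃ * I₂) * I₂ := by
      calc I₁ * I₂ * I₃ = I₁ * I₂ * I₃ * (I₂ * I₂) := by simp [hS.1.2.1]
        _ = _ := by simp only [mul_assoc]
    rw [hmove]
    exact halfTurnParabolic_ne_of_central_central_symmetry hA (hB.conj_s14 hS.1) hS c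
  · exact halfTurnParabolic_ne_of_central_central_symmetry hA hB hS c
end
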